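/- arXiv:2512.16039 — 2 statements merged into one kernel-verified Lean document; each statement's English description precedes it below -/
import Mathlib

section
/- Let G be a finitely generated group whose center Z(G) is finitely generated, and let φ be an automorphism of G. Then Fix φ is finitely generated if and only if both Fix φ̄ and P_φ are finitely generated. (This is the case n = 1 of Theorem A, since a group is of type F₁ if and only if it is finitely generated.) -/
/-- The subgroup of fixed points of an automorphism `φ` of `G`:
`Fix φ = {g ∈ G | φ(g) = g}`. -/
def fixedSubgroup {G : Type*} [Group G] (φ : G ≃* G) : Subgroup G where
  carrier := {g | φ g = g}
  one_mem' := map_one φ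
  mul_mem' := by
    intro a b ha hb
    simp only [Set.mem_setOf_eq, map_mul] at *
    rw [ha, hb]
  inv_mem' := by
    intro a ha
    simp only [Set.mem_setOf_eq, map_inv] at *
    rw [ha]

lemma center_apply_mem {G : Type*} [Group G] (φ : G ≃* G) {z : G}
    (hz : z ∈ Subgroup.center G) : φ z ∈ Subgroup.center G := by
  rw [Subgroup.mem_center_iff]
  intro g
  calc g * φ z = φ (φ.symm g) * φ z := by rw [MulEquiv.apply_symm_apply]
    _ = φ (φ.symm g * z) := by rw [map_mul]
    _ = φ (z * φ.symm g) := by rw [Subgroup.mem_center_iff.mp hz (φ.symm g)]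
    _ = φ z * φ (φ.symm g) := by rw [map_mul]
    _ = φ z * g := by rw [MulEquiv.apply_symm_apply]

/-- The subgroup `I_φ = {z⁻¹ * φ(z) | z ∈ Z(G)}` of `G` (contained in `Z(G)`). -/
def Iphi {G : Type*} [Group G] (φ : G ≃* G) : Subgroup G where
  carrier := {x | ∃ z ∈ Subgroup.center G, x = z⁻¹ * φ z}
  one_mem' := ⟨1, Subgroup.one_mem _, by simp⟩
  mul_mem' := by
    rintro a b ⟨z₁, hz₁, rfl⟩ ⟨z₂, hz₂, rfl⟩
    refine ⟨z₁ * z₂, mul_mem hz₁ hz₂, ?_⟩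
    have hc : z₂⁻¹ * (z₁⁻¹ * φ z₁) = (z₁⁻¹ * φ z₁) * z₂⁻¹ :=
      Subgroup.mem_center_iff.mp (mul_mem (inv_mem hz₁) (center_apply_mem φ hz₁)) z₂⁻¹
    calc z₁⁻¹ * φ z₁ * (z₂⁻¹ * φ z₂)
        = ((z₁⁻¹ * φ z₁) * z₂⁻¹) * φ z₂ := by simp [mul_assoc]
      _ = (z₂⁻¹ * (z₁⁻¹ * φ z₁)) * φ z₂ := by rw [hc]
      _ = (z₁ * z₂)⁻¹ * φ (z₁ * z₂) := by rw [map_mul, mul_inv_rev]; simp [mul_assoc]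
  inv_mem' := by
    rintro a ⟨z, hz, rfl⟩
    refine ⟨z⁻¹, inv_mem hz, ?_⟩
    have h : Commute z (φ z) := Subgroup.mem_center_iff.mp (center_apply_mem φ hz) z
    rw [mul_inv_rev, inv_inv, map_inv]
    exact h.inv_right.eq.symm

lemma Iphi_le_center {G : Type*} [Group G] (φ : G ≃* G) :
    Iphi φ ≤ Subgroup.center G := by
  rintro x ⟨z, hz, rfl⟩
  exact mul_mem (inv_mem hz) (center_apply_mem φ hz)

/-- The subgroup `{g ∈ G | g⁻¹ * φ(g) ∈ I_φ}` of `G`. -/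
def Qphi {G : Type*} [Group G] (φ : G ≃* G) : Subgroup G where
  carrier := {g | g⁻¹ * φ g ∈ Iphi φ}
  one_mem' := by
    simp only [Set.mem_setOf_eq, inv_one, one_mul, map_one]
    exact one_mem _
  mul_mem' := by
    intro a b ha hb
    simp only [Set.mem_setOf_eq] at *
    have hc : b⁻¹ * (a⁻¹ * φ a) = (a⁻¹ * φ a) * b⁻¹ :=
      Subgroup.mem_center_iff.mp (Iphi_le_center φ ha) b⁻¹
    have key : (a * b)⁻¹ * φ (a * b) = (a⁻¹ * φ a) * (b⁻¹ * φ b) := by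
      rw [map_mul, mul_inv_rev]
      calc b⁻¹ * a⁻¹ * (φ a * φ b)
          = (b⁻¹ * (a⁻¹ * φ a)) * φ b := by simp [mul_assoc]
        _ = ((a⁻¹ * φ a) * b⁻¹) * φ b := by rw [hc]
        _ = (a⁻¹ * φ a) * (b⁻¹ * φ b) := by rw [mul_assoc]
    rw [key]
    exact mul_mem ha hb
  inv_mem' := by
    intro a ha
    simp only [Set.mem_setOf_eq] at *
    have hc : a * (a⁻¹ * φ a)⁻¹ = (a⁻¹ * φ a)⁻¹ * a :=
      Subgroup.mem_center_iff.mp (inv_mem (Iphi_le_center φ ha)) a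
    have key : (a⁻¹)⁻¹ * φ a⁻¹ = (a⁻¹ * φ a)⁻¹ := by
      rw [inv_inv, map_inv]
      calc a * (φ a)⁻¹ = a * (a⁻¹ * φ a)⁻¹ * a⁻¹ := by group
        _ = (a⁻¹ * φ a)⁻¹ * a * a⁻¹ := by rw [hc]
        _ = (a⁻¹ * φ a)⁻¹ := by group
    rw [key]
    exact inv_mem ha

/-- The subgroup `P_φ = {gZ(G) ∈ G/Z(G) | g⁻¹ * φ(g) ∈ I_φ}` of `G/Z(G)`,
realized as the image of `{g | g⁻¹ φ(g) ∈ I_φ}` under the canonical projection. -/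
def Pphi {G : Type*} [Group G] (φ : G ≃* G) : Subgroup (G ⧸ Subgroup.center G) :=
  (Qphi φ).map (QuotientGroup.mk' (Subgroup.center G))

/-- Every subgroup of a finitely generated commutative group is finitely generated. -/
lemma Subgroup.fg_of_isMulCommutative {A : Type*} [Group A] [IsMulCommutative A]
    [Group.FG A] (K : Subgroup A) :
    K.FG := by
  have : AddGroup.FG (Additive A) := inferInstance
  let : CommGroup A := { ‹Group A› with mul_comm := mul_comm' }
  have : Module.Finite ℤ (Additive A) := Module.Finite.iff_addGroup_fg.mpr inferInstance
  rw [Subgroup.fg_iff_add_fg, ← AddSubgroup.toIntSubmodule_toAddSubgroup K.toAddSubgroup,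
    ← Submodule.fg_iff_addSubgroup_fg]
  exact IsNoetherian.noetherian _

lemma Subgroup.FG.map {G H : Type*} [Group G] [Group H] {S : Subgroup G} (hS : S.FG)
    (f : G →* H) : (S.map f).FG := by
  classical
  obtain ⟨T, rfl⟩ := hS
  exact ⟨T.image f, by rw [Finset.coe_image, MonoidHom.map_closure]⟩

/-- A subgroup contained in a finitely generated center is finitely generated. -/
lemma Subgroup.fg_of_le_center {G : Type*} [Group G] (hZ : Group.FG (Subgroup.center G))
    {K : Subgroup G} (hK : K ≤ Subgroup.center G) : K.FG := by
  rw [← Subgroup.map_subgroupOf_eq_of_le hK]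
  exact (Subgroup.fg_of_isMulCommutative _).map _

lemma Subgroup.fg_of_fg_map_of_fg_inf_ker {G H : Type*} [Group G] [Group H] (f : G →* H)
    {S : Subgroup G} (hmap : (S.map f).FG) (hker : (S ⊓ f.ker).FG) : S.FG := by
  classical
  obtain ⟨T, hT⟩ := hmap
  have hTS : (T : Set H) ⊆ f '' S := by
    rw [← Subgroup.coe_map, ← hT]
    exact Subgroup.subset_closure
  obtain ⟨U, hUS, rfl⟩ := Finset.subset_set_image_iff.mp hTS
  have hU : Subgroup.closure (U : Set G) ≤ S := (Subgroup.closure_le S).mpr hUS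
  rw [Finset.coe_image, ← MonoidHom.map_closure] at hT
  have hS : Subgroup.closure (U : Set G) ⊔ (S ⊓ f.ker) = S := by
    refine le_antisymm (sup_le hU inf_le_left) fun s hs ↦ ?_
    obtain ⟨u, hu, hus⟩ : f s ∈ (Subgroup.closure (U : Set G)).map f :=
      hT ▸ Subgroup.mem_map_of_mem f hs
    have hk : u⁻¹ * s ∈ S ⊓ f.ker :=
      Subgroup.mem_inf.mpr ⟨mul_mem (inv_mem (hU hu)) hs, by simp [MonoidHom.mem_ker, hus]⟩
    rw [← mul_inv_cancel_left u s]
    exact Subgroup.mul_mem_sup hu hk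
  rw [← hS]
  exact Subgroup.FG.sup ⟨U, rfl⟩ hker

/-- The subgroup `P_φ` is the image of `Fix φ` in `G/Z(G)`. -/
lemma Pphi_eq_map_fixedSubgroup {G : Type*} [Group G] (φ : G ≃* G) :
    Pphi φ = (fixedSubgroup φ).map (QuotientGroup.mk' (Subgroup.center G)) := by
  apply le_antisymm
  · rintro _ ⟨g, ⟨z, hz, hg⟩, rfl⟩
    refine ⟨g * z⁻¹, ?_, ?_⟩
    · have hφg : φ g = g * (z⁻¹ * φ z) := by rw [← hg, mul_inv_cancel_left]
      change φ (g * z⁻¹) = g * z⁻¹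
      rw [map_mul, map_inv, hφg]
      group
    · simpa [QuotientGroup.eq] using hz
  · refine Subgroup.map_mono fun g hg ↦ ?_
    change g⁻¹ * φ g ∈ Iphi φ
    rw [show φ g = g from hg, inv_mul_cancel]
    exact one_mem _

/-- The homomorphism `g ↦ g⁻¹ * φ(g)` to the center, on a subgroup `S` of elements for which
this value is central. -/
def centralDisplacement {G : Type*} [Group G] (φ : G ≃* G) (S : Subgroup G)
    (hS : ∀ g ∈ S, g⁻¹ * φ g ∈ Subgroup.center G) : S →* Subgroup.center G where
  toFun g := ⟨(g : G)⁻¹ * φ g, hS g g.2⟩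
  map_one' := by simp
  map_mul' a b := by
    ext
    have hc := Subgroup.mem_center_iff.mp (hS a a.2) (b : G)⁻¹
    simp only [Subgroup.coe_mul, map_mul, mul_inv_rev]
    calc (b : G)⁻¹ * (a : G)⁻¹ * (φ a * φ b)
        = (b : G)⁻¹ * ((a : G)⁻¹ * φ a) * φ b := by simp only [mul_assoc]
      _ = (a : G)⁻¹ * φ a * ((b : G)⁻¹ * φ b) := by rw [hc, mul_assoc]

lemma ker_centralDisplacement {G : Type*} [Group G] (φ : G ≃* G) (S : Subgroup G)
    (hS : ∀ g ∈ S, g⁻¹ * φ g ∈ Subgroup.center G) :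
    (centralDisplacement φ S hS).ker = (fixedSubgroup φ).subgroupOf S := by
  ext g
  rw [MonoidHom.mem_ker, Subgroup.mem_subgroupOf, Subtype.ext_iff]
  change (g : G)⁻¹ * φ g = 1 ↔ φ g = g
  rw [inv_mul_eq_one, eq_comm]

lemma Subgroup.fg_of_fixedSubgroup_fg {G : Type*} [Group G]
    (hZ : Group.FG (Subgroup.center G)) (φ : G ≃* G) {S : Subgroup G}
    (hS : ∀ g ∈ S, g⁻¹ * φ g ∈ Subgroup.center G) (hfix : fixedSubgroup φ ≤ S)
    (h : (fixedSubgroup φ).FG) : S.FG := by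
  rw [← Group.fg_iff_subgroup_fg, Group.fg_def]
  refine Subgroup.fg_of_fg_map_of_fg_inf_ker (centralDisplacement φ S hS)
    (Subgroup.fg_of_isMulCommutative _) ?_
  rw [top_inf_eq, ker_centralDisplacement, ← Group.fg_iff_subgroup_fg]
  have := (Group.fg_iff_subgroup_fg _).mpr h
  exact Group.fg_of_surjective (f := (Subgroup.subgroupOfEquivOfLe hfix).symm.toMonoidHom)
    (Subgroup.subgroupOfEquivOfLe hfix).symm.surjective

/-- (Theorem A with n = 1.) For a finitely generated group `G` with
finitely generated center, `Fix φ` is finitely generated iff both `Fix φ̄` and `P_φ`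
are finitely generated. -/
theorem fixed_fg_iff_fixedBar_and_Pphi_fg {G : Type*} [Group G]
    (hG : Group.FG G) (hZ : Group.FG ↥(Subgroup.center G)) (φ : G ≃* G)
    (φbar : (G ⧸ Subgroup.center G) ≃* (G ⧸ Subgroup.center G))
    (hbar : ∀ g : G, φbar (QuotientGroup.mk g) = QuotientGroup.mk (φ g)) :
    Group.FG ↥(fixedSubgroup φ) ↔
      (Group.FG ↥(fixedSubgroup φbar) ∧ Group.FG ↥(Pphi φ)) := by
  simp only [Group.fg_iff_subgroup_fg, Pphi_eq_map_fixedSubgroup]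
  let π := QuotientGroup.mk' (Subgroup.center G)
  have hmem (g : G) : g ∈ (fixedSubgroup φbar).comap π ↔
      g⁻¹ * φ g ∈ Subgroup.center G := by
    change φbar (QuotientGroup.mk g) = QuotientGroup.mk g ↔ _
    rw [hbar, eq_comm, QuotientGroup.eq]
  refine ⟨fun h ↦ ⟨?_, h.map _⟩, fun ⟨_, hP⟩ ↦ ?_⟩
  · rw [← Subgroup.map_comap_eq_self_of_surjective
      (QuotientGroup.mk'_surjective (Subgroup.center G)) (fixedSubgroup φbar)]
    refine (Subgroup.fg_of_fixedSubgroup_fg hZ φ (fun g ↦ (hmem g).mp) (fun g hg ↦ ?_) h).map _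
    rw [hmem, show φ g = g from hg, inv_mul_cancel]
    exact one_mem _
  · refine Subgroup.fg_of_fg_map_of_fg_inf_ker _ hP (Subgroup.fg_of_le_center hZ ?_)
    rw [QuotientGroup.ker_mk']
    exact inf_le_right
end

section
/- Let F be a free group of rank 2 and let H = (F × F) ⋊ C₂ be the wreath product F ≀ C₂, where the nontrivial element of the cyclic group C₂ of order 2 acts on F × F by swapping the two coordinates. Then H has property FGFPa (every automorphism of H has finitely generated fixed subgroup) and the commutator subgroup H' is finitely generated. -/
/-- A group `G` has property FGFPa if the fixed subgroup of every automorphism of `G`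
is finitely generated. -/
def FGFPa (G : Type*) [Group G] : Prop :=
  ∀ φ : G ≃* G, Group.FG ↥(fixedSubgroup φ)

/-- The free group of rank 2. -/
abbrev F₂ : Type := FreeGroup (Fin 2)

/-- The cyclic group of order 2, written multiplicatively. -/
abbrev C₂ : Type := Multiplicative (ZMod 2)

section Flow

variable {G V : Type*} [Group G] [MulAction G V]

/-- One step of the flow on a `G`-set in which every point `v` is moved by its label `ℓ v`. -/
def flowStep (ℓ : V → G) (v : V) : V := ℓ v • v

/-- The group element read along the first `n` steps of the flow starting at `v`. -/
def flowLabel (ℓ : V → G) : ℕ → V → G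
  | 0, _ => 1
  | n + 1, v => flowLabel ℓ n (flowStep ℓ v) * ℓ v

theorem flowLabel_smul (ℓ : V → G) (n : ℕ) (v : V) :
    flowLabel ℓ n v • v = (flowStep ℓ)^[n] v := by
  induction n generalizing v with
  | zero => simp [flowLabel]
  | succ n ih => rw [flowLabel, mul_smul, Function.iterate_succ_apply, ← ih]; rfl

theorem flowLabel_add (ℓ : V → G) (m n : ℕ) (v : V) :
    flowLabel ℓ (m + n) v = flowLabel ℓ m ((flowStep ℓ)^[n] v) * flowLabel ℓ n v := by
  induction n generalizing v with
  | zero => simp [flowLabel]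
  | succ n ih =>
    rw [← add_assoc, flowLabel, ih, flowLabel, mul_assoc, Function.iterate_succ_apply]

theorem flowLabel_mul_of_isPeriodicPt (ℓ : V → G) {p : ℕ} {v : V}
    (hv : Function.IsPeriodicPt (flowStep ℓ) p v) (j : ℕ) :
    flowLabel ℓ (p * j) v = flowLabel ℓ p v ^ j := by
  induction j with
  | zero => simp [flowLabel]
  | succ j ih => rw [Nat.mul_succ, flowLabel_add, hv.eq, ih, pow_succ]

/-- `t` is read along a path from `v` to `w` which follows the flow forwards from `v` and then
backwards to `w`. -/
def FlowConnects (ℓ : V → G) (v w : V) (t : G) : Prop :=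
  ∃ m n, (flowStep ℓ)^[m] v = (flowStep ℓ)^[n] w ∧ t = (flowLabel ℓ n w)⁻¹ * flowLabel ℓ m v

theorem FlowConnects.smul_eq {ℓ : V → G} {v w : V} {t : G} (h : FlowConnects ℓ v w t) :
    t • v = w := by
  obtain ⟨m, n, e, rfl⟩ := h
  rw [mul_smul, flowLabel_smul, e, ← flowLabel_smul, inv_smul_smul]

theorem FlowConnects.refl (ℓ : V → G) (v : V) : FlowConnects ℓ v v 1 :=
  ⟨0, 0, rfl, by simp [flowLabel]⟩

theorem FlowConnects.extend {ℓ : V → G} {v w : V} {m n : ℕ}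
    (e : (flowStep ℓ)^[m] v = (flowStep ℓ)^[n] w) (k : ℕ) :
    (flowStep ℓ)^[k + m] v = (flowStep ℓ)^[k + n] w ∧
      (flowLabel ℓ (k + n) w)⁻¹ * flowLabel ℓ (k + m) v =
        (flowLabel ℓ n w)⁻¹ * flowLabel ℓ m v := by
  constructor
  · rw [Function.iterate_add_apply, Function.iterate_add_apply, e]
  · rw [flowLabel_add, flowLabel_add, e]; group

/-- Appending a step of the flow. -/
theorem FlowConnects.forward {ℓ : V → G} {v w : V} {t : G} (h : FlowConnects ℓ v w t) :
    FlowConnects ℓ v (ℓ w • w) (ℓ w * t) := by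
  obtain ⟨m, n, e, rfl⟩ := h
  obtain ⟨e', h'⟩ := FlowConnects.extend e 1
  refine ⟨1 + m, n, ?_, ?_⟩
  · rw [e', add_comm 1 n, Function.iterate_succ_apply]; rfl
  · rw [← h', add_comm 1 n, flowLabel, mul_inv_rev, mul_assoc, mul_inv_cancel_left]; rfl

/-- Appending a step against the flow. -/
theorem FlowConnects.backward {ℓ : V → G} {v w : V} {t x : G} (h : FlowConnects ℓ v w t)
    (hx : x⁻¹ = ℓ (x • w)) : FlowConnects ℓ v (x • w) (x * t) := by
  obtain ⟨m, n, e, rfl⟩ := h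
  have hs : flowStep ℓ (x • w) = w := by rw [flowStep, ← hx, inv_smul_smul]
  refine ⟨m, n + 1, ?_, ?_⟩
  · rw [e, Function.iterate_succ_apply, hs]
  · rw [flowLabel, hs, ← hx]; group

/-- Loops of the flow at a given point form a cyclic group. -/
theorem exists_flowLoop_mem_zpowers (ℓ : V → G) (s : V) :
    ∃ c : G, c • s = s ∧ ∀ m n, (flowStep ℓ)^[m] s = (flowStep ℓ)^[n] s →
      (flowLabel ℓ m s)⁻¹ * flowLabel ℓ n s ∈ Subgroup.zpowers c := by
  set T := flowStep ℓ with hT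
  suffices H : ∃ c : G, c • s = s ∧ ∀ m d, T^[m] s = T^[m + d] s →
      (flowLabel ℓ m s)⁻¹ * flowLabel ℓ (m + d) s ∈ Subgroup.zpowers c by
    obtain ⟨c, hc, H⟩ := H
    refine ⟨c, hc, fun m n e => ?_⟩
    rcases le_total m n with h | h
    · obtain ⟨d, rfl⟩ := Nat.exists_eq_add_of_le h
      exact H m d e
    · obtain ⟨d, rfl⟩ := Nat.exists_eq_add_of_le h
      have := inv_mem (H n d e.symm)
      rwa [mul_inv_rev, inv_inv] at this
  by_cases h : ∃ a, T^[a] s ∈ Function.periodicPts T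
  · obtain ⟨a, ha⟩ := h
    set r := T^[a] s with hr
    set p := Function.minimalPeriod T r
    have hp : Function.IsPeriodicPt T p r := Function.isPeriodicPt_minimalPeriod T r
    refine ⟨(flowLabel ℓ a s)⁻¹ * flowLabel ℓ p r * flowLabel ℓ a s, ?_, fun m d e => ?_⟩
    · rw [mul_smul, mul_smul, flowLabel_smul, ← hT, ← hr, flowLabel_smul, ← hT, hp.eq, hr,
        hT, ← flowLabel_smul, inv_smul_smul]
    · have e1 := (FlowConnects.extend e.symm a).2
      rw [← e1, add_comm a m, add_comm a (m + d), flowLabel_add, flowLabel_add, ← hT, ← hr]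
      have e2 : T^[m] r = T^[m + d] r := by
        rw [hr, ← Function.iterate_add_apply, ← Function.iterate_add_apply, add_comm m a,
          add_comm (m + d) a, Function.iterate_add_apply, Function.iterate_add_apply, e]
      have e3 : Function.IsPeriodicPt T d (T^[m] r) := by
        rw [Function.IsPeriodicPt, Function.IsFixedPt, ← Function.iterate_add_apply, add_comm d m,
          ← e2]
      have e4 : p ∣ d := by
        have := e3.minimalPeriod_dvd
        rwa [Function.minimalPeriod_apply_iterate ha] at this
      obtain ⟨j, rfl⟩ := e4
      rw [flowLabel_add, (hp.mul_const j).eq, flowLabel_mul_of_isPeriodicPt ℓ hp]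
      refine ⟨j, ?_⟩
      have := conj_pow (i := j) (a := (flowLabel ℓ a s)⁻¹) (b := flowLabel ℓ p r)
      rw [inv_inv] at this
      simp only [zpow_natCast]
      rw [this]; group
  · refine ⟨1, one_smul _ _, fun m d e => ?_⟩
    have hd : d = 0 := by
      by_contra hd
      refine h ⟨m, d, Nat.pos_of_ne_zero hd, ?_⟩
      rw [Function.IsPeriodicPt, Function.IsFixedPt, ← Function.iterate_add_apply, add_comm d m,
        ← e]
    subst hd
    simp

theorem FlowConnects.inv_mul_mem_zpowers {ℓ : V → G} {v w : V} {t t' c : G}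
    (hc : ∀ m n, (flowStep ℓ)^[m] v = (flowStep ℓ)^[n] v →
      (flowLabel ℓ m v)⁻¹ * flowLabel ℓ n v ∈ Subgroup.zpowers c)
    (h : FlowConnects ℓ v w t) (h' : FlowConnects ℓ v w t') :
    t⁻¹ * t' ∈ Subgroup.zpowers c := by
  obtain ⟨m, n, e, rfl⟩ := h
  obtain ⟨m', n', e', rfl⟩ := h'
  obtain ⟨e₁, h₁⟩ := FlowConnects.extend e n'
  obtain ⟨e₂, h₂⟩ := FlowConnects.extend e' n
  rw [add_comm n' n] at e₁ h₁
  rw [← h₁, ← h₂, mul_inv_rev, inv_inv, mul_assoc, mul_inv_cancel_left]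
  exact hc _ _ (e₁.trans e₂.symm)

/-- If `G` is generated by the finite set `X` and, apart from finitely many exceptions, every edge
`v → x • v` of the Schreier graph of a `G`-set is a step of the flow in one of its directions,
then point stabilizers are finitely generated. -/
theorem stabilizer_fg_of_flow (ℓ : V → G) {X : Set G} (hX : X.Finite)
    (hXtop : Submonoid.closure X = ⊤) {S : Set V} (hS : S.Finite) {s₀ : V} (hs₀ : s₀ ∈ S)
    (h : ∀ x ∈ X, ∀ v : V, (v ∈ S ∧ x • v ∈ S) ∨ x = ℓ v ∨ x⁻¹ = ℓ (x • v)) :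
    (MulAction.stabilizer G s₀).FG := by
  classical
  choose c hc hcz using exists_flowLoop_mem_zpowers ℓ
  obtain ⟨p, hp₀, hp⟩ : ∃ p : V → G, p s₀ = 1 ∧ ∀ g : G, p (g • s₀) • s₀ = g • s₀ := by
    refine ⟨fun v => if v = s₀ then 1 else if hv : ∃ g : G, g • s₀ = v then hv.choose else 1,
      by simp, fun g => ?_⟩
    by_cases hg : g • s₀ = s₀
    · simp [hg]
    · have hv : ∃ g' : G, g' • s₀ = g • s₀ := ⟨g, rfl⟩
      simp only [hg, if_false, dif_pos hv]
      exact hv.choose_spec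
  obtain ⟨q, hq⟩ : ∃ q : V → V → G, ∀ v w t, FlowConnects ℓ v w t →
      FlowConnects ℓ v w (q v w) := by
    refine ⟨fun v w => if hv : ∃ t, FlowConnects ℓ v w t then hv.choose else 1,
      fun v w t ht => ?_⟩
    have hv : ∃ t, FlowConnects ℓ v w t := ⟨t, ht⟩
    simp only [dif_pos hv]
    exact hv.choose_spec
  set Y : Set G := ((fun s => (p s)⁻¹ * c s * p s) '' S ∪
    (fun a : V × V => (p a.2)⁻¹ * q a.1 a.2 * p a.1) '' (S ×ˢ S)) ∪
    (fun a : G × V => (p (a.1 • a.2))⁻¹ * a.1 * p a.2) '' (X ×ˢ S)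
  have hYfin : Y.Finite :=
    ((hS.image _).union ((hS.prod hS).image _)).union ((hX.prod hS).image _)
  set K := Subgroup.closure (Y ∩ MulAction.stabilizer G s₀)
  have hmem : ∀ s s' w, p s • s₀ = s → p s' • s₀ = s' → w • s = s' →
      (p s')⁻¹ * w * p s ∈ Y → (p s')⁻¹ * w * p s ∈ K := by
    intro s s' w h1 h2 h3 h4
    refine Subgroup.subset_closure ⟨h4, ?_⟩
    rw [SetLike.mem_coe, MulAction.mem_stabilizer_iff, mul_smul, mul_smul, h1, h3,
      inv_smul_eq_iff, h2]
  have hconn : ∀ s ∈ S, ∀ s' ∈ S, p s • s₀ = s → p s' • s₀ = s' → ∀ t, FlowConnects ℓ s s' t →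
      (p s')⁻¹ * t * p s ∈ K := by
    intro s hs s' hs' h1 h2 t ht
    have hqs := hq s s' t ht
    obtain ⟨j, hj⟩ := FlowConnects.inv_mul_mem_zpowers (hcz s) hqs ht
    have hqK : (p s')⁻¹ * q s s' * p s ∈ K :=
      hmem s s' _ h1 h2 hqs.smul_eq (Or.inl (Or.inr ⟨(s, s'), ⟨hs, hs'⟩, rfl⟩))
    have hcK : (p s)⁻¹ * c s * p s ∈ K :=
      hmem s s _ h1 h1 (hc s) (Or.inl (Or.inl ⟨s, hs, rfl⟩))
    have e : (p s')⁻¹ * t * p s =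
        ((p s')⁻¹ * q s s' * p s) * ((p s)⁻¹ * c s * p s) ^ j := by
      have := conj_zpow (i := j) (a := (p s)⁻¹) (b := c s)
      simp only [inv_inv] at this hj
      rw [this, hj]; group
    rw [e]
    exact mul_mem hqK (zpow_mem hcK j)
  have key : ∀ w : G, ∃ s ∈ S, p s • s₀ = s ∧ ∃ t, FlowConnects ℓ s (w • s₀) t ∧
      ∃ k ∈ K, w = t * p s * k := by
    intro w
    have hw : w ∈ Submonoid.closure X := hXtop ▸ Submonoid.mem_top w
    induction hw using Submonoid.closure_induction_left with
    | one =>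
      exact ⟨s₀, hs₀, by rw [hp₀, one_smul], 1, by rw [one_smul]; exact .refl ℓ s₀, 1, one_mem _,
        by simp [hp₀]⟩
    | mul_left x hx w _ ih =>
      obtain ⟨s, hs, hps, t, ht, k, hk, hw⟩ := ih
      rcases h x hx (w • s₀) with ⟨h1, h2⟩ | h1 | h1
      · have hv := hp w
        have hxv : p (x • w • s₀) • s₀ = x • w • s₀ := by rw [← mul_smul, hp]
        refine ⟨x • w • s₀, h2, hxv, 1, by rw [mul_smul]; exact .refl _ _, _,
          mul_mem (mul_mem (hmem _ _ x hv hxv rfl (Or.inr ⟨(x, w • s₀), ⟨hx, h1⟩, rfl⟩))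
            (hconn s hs _ h1 hps hv t ht)) hk, ?_⟩
        nth_rewrite 1 [hw]
        group
      · refine ⟨s, hs, hps, x * t, ?_, k, hk, by rw [hw]; group⟩
        rw [mul_smul, h1]
        exact ht.forward
      · refine ⟨s, hs, hps, x * t, ?_, k, hk, by rw [hw]; group⟩
        rw [mul_smul]
        exact ht.backward h1
  have hKeq : K = MulAction.stabilizer G s₀ := by
    refine le_antisymm ((Subgroup.closure_le _).2 Set.inter_subset_right) fun g hg => ?_
    obtain ⟨s, hs, hps, t, ht, k, hk, rfl⟩ := key g
    rw [MulAction.mem_stabilizer_iff.1 hg] at ht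
    have := hconn s hs s₀ hs₀ hps (by rw [hp₀, one_smul]) t ht
    rw [hp₀, inv_one, one_mul] at this
    exact mul_mem this hk
  rw [Subgroup.fg_iff]
  exact ⟨_, hKeq, hYfin.inter_of_left _⟩

end Flow

namespace FreeGroup

variable {α : Type*} [DecidableEq α]

theorem toWord_mk_singleton_mul (c : α × Bool) (w : FreeGroup α) :
    (mk [c] * w).toWord = reduce (c :: w.toWord) := by
  rw [toWord_mul, toWord_mk]; rfl

/-- Left multiplication by a word shorter than `w` does not affect the last letter of `w`. -/
theorem getLast?_toWord_mk_mul {w : FreeGroup α} {l : α × Bool}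
    (hl : w.toWord.getLast? = some l) (v : List (α × Bool)) (hv : v.length < w.norm) :
    (mk v * w).toWord.getLast? = some l ∧ w.norm ≤ (mk v * w).norm + v.length := by
  induction v with
  | nil => rw [← one_eq_mk, one_mul]; exact ⟨hl, le_rfl⟩
  | cons c v ih =>
    simp only [List.length_cons] at hv
    obtain ⟨h1, h2⟩ := ih (by omega)
    have e : mk (c :: v) * w = mk [c] * (mk v * w) := by
      rw [← mul_assoc, mul_mk]; rfl
    rw [e]
    generalize mk v * w = g at h1 h2 ⊢
    simp only [norm, toWord_mk_singleton_mul, reduce.cons, reduce_toWord] at h2 ⊢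
    rw [norm] at hv
    rcases hg : g.toWord with - | ⟨a, tl⟩
    · simp [hg] at h1
    · rw [hg] at h1 h2
      simp only [List.length_cons] at h2 ⊢
      split_ifs
      · have : tl ≠ [] := by rintro rfl; simp at h2; omega
        obtain ⟨b, tl', rfl⟩ := List.exists_cons_of_ne_nil this
        rw [List.getLast?_cons_cons] at h1
        exact ⟨h1, by omega⟩
      · rw [List.getLast?_cons_cons]
        exact ⟨h1, by simp only [List.length_cons]; omega⟩

theorem toWord_mul_inv_mk_singleton {g : FreeGroup α} {c : α × Bool}
    (h : g.toWord.getLast? ≠ some c) :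
    (g * (mk [c])⁻¹).toWord = g.toWord ++ [(c.1, !c.2)] := by
  have e : g * (mk [c])⁻¹ = mk (g.toWord ++ [(c.1, !c.2)]) := by
    rw [← mul_mk, mk_toWord, inv_mk]; rfl
  rw [e, toWord_mk]
  refine IsReduced.reduce_eq ?_
  rw [IsReduced, List.isChain_append]
  refine ⟨isReduced_toWord, by simp, ?_⟩
  intro a ha b hb hab
  simp only [List.head?_cons, Option.mem_some_iff] at hb
  subst hb
  by_contra hne
  refine h ?_
  rw [Option.mem_def] at ha
  rw [ha]
  refine congrArg some (Prod.ext hab ?_)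
  revert hne
  cases a.2 <;> cases c.2 <;> simp

/-- The last letter of the reduced word of `g`, or `1` if `g = 1`. -/
def lastLetter (g : FreeGroup α) : FreeGroup α :=
  (g.toWord.getLast?).elim 1 fun c => mk [c]

theorem finite_setOf_norm_le [Finite α] (n : ℕ) : {g : FreeGroup α | g.norm ≤ n}.Finite :=
  (List.finite_length_le (α × Bool) n).preimage toWord_injective.injOn

theorem submonoid_closure_range_mk_singleton :
    Submonoid.closure (Set.range fun c : α × Bool => mk [c]) = ⊤ := by
  refine eq_top_iff.2 fun g _ => ?_
  rw [← mk_toWord (x := g)]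
  induction g.toWord with
  | nil => exact one_mem _
  | cons c v ih =>
    have e : mk (c :: v) = mk [c] * mk v := by rw [mul_mk]; rfl
    rw [e]
    exact mul_mem (Submonoid.subset_closure ⟨c, rfl⟩) ih

end FreeGroup

/-- The group `G` with the twisted conjugation action `w • g = φ w * g * w⁻¹`. -/
def TwistedConj {G : Type*} [Group G] (_ : G →* G) : Type _ := G

instance TwistedConj.instMulAction {G : Type*} [Group G] (φ : G →* G) :
    MulAction G (TwistedConj φ) where
  smul w g := (φ w * (show G from g) * w⁻¹ : G)
  one_smul := fun (g : G) => show φ 1 * g * 1⁻¹ = g by simp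
  mul_smul := fun a b (g : G) =>
    show φ (a * b) * g * (a * b)⁻¹ = φ a * (φ b * g * b⁻¹) * a⁻¹ by simp [mul_assoc]

/-- The fixed subgroup of an endomorphism of a free group of finite rank is finitely generated. -/
theorem FreeGroup.eqLocus_id_fg {α : Type*} [Finite α] (φ : FreeGroup α →* FreeGroup α) :
    (φ.eqLocus (MonoidHom.id _)).FG := by
  classical
  have hstab : φ.eqLocus (MonoidHom.id _) =
      MulAction.stabilizer (FreeGroup α) (show TwistedConj φ from (1 : FreeGroup α)) := by
    ext w
    change φ w = w ↔ φ w * 1 * w⁻¹ = 1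
    rw [mul_one, mul_inv_eq_one]
  obtain ⟨N, hN⟩ : ∃ N, ∀ c : α × Bool, (φ (mk [c])).norm ≤ N := by
    obtain ⟨N, hN⟩ := (Set.finite_range fun c : α × Bool => (φ (mk [c])).norm).bddAbove
    exact ⟨N, fun c => hN ⟨c, rfl⟩⟩
  rw [hstab]
  refine stabilizer_fg_of_flow (V := TwistedConj φ) (fun g => lastLetter (show FreeGroup α from g))
    (Set.finite_range fun c : α × Bool => mk [c]) submonoid_closure_range_mk_singleton
    (S := {g : FreeGroup α | g.norm ≤ 2 * N + 1}) (finite_setOf_norm_le _)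
    (by change norm (1 : FreeGroup α) ≤ _; simp) ?_
  rintro _ ⟨c, rfl⟩ (g : FreeGroup α)
  change (g.norm ≤ _ ∧ (φ (mk [c]) * g * (mk [c])⁻¹).norm ≤ _) ∨ mk [c] = lastLetter g ∨
    (mk [c])⁻¹ = lastLetter (φ (mk [c]) * g * (mk [c])⁻¹)
  by_cases hg : g.toWord.getLast? = some c
  · exact Or.inr (Or.inl (by simp [lastLetter, hg]))
  have hw := toWord_mul_inv_mk_singleton hg
  have hnorm : (g * (mk [c])⁻¹).norm = g.norm + 1 := by
    rw [norm, hw, List.length_append]; rfl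
  rw [mul_assoc]
  by_cases hlt : (φ (mk [c])).norm < g.norm + 1
  · right; right
    have := (getLast?_toWord_mk_mul (w := g * (mk [c])⁻¹) (l := (c.1, !c.2)) (by rw [hw]; simp)
      (φ (mk [c])).toWord (by rw [hnorm]; exact hlt)).1
    rw [mk_toWord] at this
    rw [lastLetter, this, inv_mk]; rfl
  · left
    have h1 := hN c
    have h2 := norm_mul_le (φ (mk [c])) (g * (mk [c])⁻¹)
    constructor <;> omega

namespace FreeGroup

theorem commute_map_of_commute {α M : Type*} [Group M] (f : FreeGroup α →* M)
    (h : ∀ i j, Commute (f (of i)) (f (of j))) (x y : FreeGroup α) : Commute (f x) (f y) := by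
  have aux : ∀ (m : M), (∀ i, Commute m (f (of i))) → ∀ x, Commute m (f x) := by
    intro m hm x
    induction x using FreeGroup.induction_on with
    | C1 => rw [_root_.map_one]; exact Commute.one_right m
    | of i => exact hm i
    | inv_of i hi => rw [_root_.map_inv]; exact hi.inv_right
    | mul x y hx hy => rw [_root_.map_mul]; exact hx.mul_right hy
  exact aux _ (fun i => (aux _ (fun j => h i j) x).symm) y

theorem eq_one_of_forall_commute {α : Type*} [Nontrivial α] {w : FreeGroup α}
    (hw : ∀ g, Commute w g) : w = 1 := by
  classical
  by_contra hne
  obtain ⟨l, hl⟩ : ∃ l, w.toWord.getLast? = some l := by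
    rw [← Option.isSome_iff_exists, Option.isSome_iff_ne_none, Ne, List.getLast?_eq_none_iff,
      toWord_eq_nil_iff]
    exact hne
  obtain ⟨b, hb⟩ := exists_ne l.1
  have h1 : (w * (mk [(b, true)])⁻¹).toWord = w.toWord ++ [(b, false)] :=
    toWord_mul_inv_mk_singleton (by rw [hl]; rintro ⟨rfl⟩; exact hb rfl)
  have h2 : w * (mk [(b, true)])⁻¹ = mk [(b, false)] * w := (hw _).eq
  rw [h2, toWord_mk_singleton_mul, reduce.cons, reduce_toWord] at h1
  rcases hg : w.toWord with - | ⟨a, tl⟩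
  · simp [hg] at hl
  · rw [hg] at hl h1
    simp only at h1
    split_ifs at h1
    · have := congrArg List.length h1
      simp only [List.length_append, List.length_cons, List.length_nil] at this
      omega
    · have := congrArg List.getLast? h1
      rw [List.getLast?_cons_cons, hl, List.getLast?_concat, Option.some_inj] at this
      rw [this] at hb
      exact hb rfl

theorem eq_one_of_commute_of_not_commute {α : Type*} {a b c : FreeGroup α}
    (hab : ¬ Commute a b) (hca : Commute c a) (hcb : Commute c b) : c = 1 := by
  set C := Subgroup.centralizer {c} with hC
  have hmem : ∀ {g}, Commute c g → g ∈ C := fun h => by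
    rw [hC, Subgroup.mem_centralizer_singleton_iff]
    exact h.symm.eq
  let e := IsFreeGroup.toFreeGroup C
  let c' : C := ⟨c, hmem (Commute.refl c)⟩
  have hc' : ∀ g, Commute (e c') g := by
    intro g
    obtain ⟨g, rfl⟩ := e.surjective g
    refine Commute.map ?_ e
    have := Subgroup.mem_centralizer_singleton_iff.1 g.2
    exact Subtype.ext this.symm
  rcases subsingleton_or_nontrivial (IsFreeGroup.Generators C) with h | h
  · refine absurd ?_ hab
    have := commute_map_of_commute e.symm.toMonoidHom (fun i j => by
      rw [Subsingleton.elim i j]; exact Commute.refl _) (e ⟨a, hmem hca⟩) (e ⟨b, hmem hcb⟩)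
    simp only [MulEquiv.toMonoidHom_eq_coe, MonoidHom.coe_coe, MulEquiv.symm_apply_apply] at this
    exact congrArg Subtype.val this.eq
  · have := eq_one_of_forall_commute hc'
    rw [MulEquiv.map_eq_one_iff] at this
    exact congrArg Subtype.val this

end FreeGroup

section Wreath

variable {act : C₂ →* MulAut (F₂ × F₂)}

theorem C₂.eq_one_or (c : C₂) : c = 1 ∨ c = Multiplicative.ofAdd 1 := by
  revert c; decide

theorem C₂.mul_self (c : C₂) : c * c = 1 := by
  revert c; decide

theorem wreath_left_mul {p : (F₂ × F₂) ⋊[act] C₂} (hp : p.right = 1)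
    (q : (F₂ × F₂) ⋊[act] C₂) : (p * q).left = p.left * q.left := by
  rw [SemidirectProduct.mul_left, hp, map_one]; rfl

theorem wreath_eq_inl {p : (F₂ × F₂) ⋊[act] C₂} (hp : p.right = 1) :
    p = SemidirectProduct.inl p.left :=
  SemidirectProduct.ext (by simp) (by simp [hp])

theorem wreath_commute_left {p q : (F₂ × F₂) ⋊[act] C₂} (hp : p.right = 1) (hq : q.right = 1)
    (h : Commute p q) : Commute p.left q.left := by
  rw [Commute, SemiconjBy, ← wreath_left_mul hp, ← wreath_left_mul hq, h.eq]

/-- A free subgroup of the wreath product commuting with two base elements that do not commute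
in a coordinate lies in the base group and is trivial in this coordinate. -/
theorem wreath_right_eq_one_of_commute
    (hact : ∀ x : F₂ × F₂, act (Multiplicative.ofAdd 1) x = (x.2, x.1))
    (π : F₂ × F₂ →* F₂) (hπ : ∀ x : F₂ × F₂, π (x * (x.2, x.1)) = 1 → x * (x.2, x.1) = 1)
    {θ : F₂ →* (F₂ × F₂) ⋊[act] C₂} (hθ : Function.Injective θ)
    {p q : (F₂ × F₂) ⋊[act] C₂} (hp : p.right = 1) (hq : q.right = 1)
    (hpq : ¬ Commute (π p.left) (π q.left))
    (hθp : ∀ b, Commute (θ b) p) (hθq : ∀ b, Commute (θ b) q) (b : F₂) :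
    (θ b).right = 1 ∧ π (θ b).left = 1 := by
  have key : ∀ b, (θ b).right = 1 → π (θ b).left = 1 := fun b hb =>
    FreeGroup.eq_one_of_commute_of_not_commute hpq
      ((wreath_commute_left hb hp (hθp b)).map π) ((wreath_commute_left hb hq (hθq b)).map π)
  rcases C₂.eq_one_or (θ b).right with hb | hb
  · exact ⟨hb, key b hb⟩
  · have hr : (θ (b * b)).right = 1 := by
      rw [map_mul, SemidirectProduct.mul_right, C₂.mul_self]
    have hl : (θ (b * b)).left = (θ b).left * ((θ b).left.2, (θ b).left.1) := by
      rw [map_mul, SemidirectProduct.mul_left, hb, hact]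
    have h1 : (θ (b * b)).left = 1 := by
      rw [hl]; exact hπ _ (hl ▸ key _ hr)
    have h2 : θ (b * b) = 1 := SemidirectProduct.ext h1 hr
    have h3 : b ^ 2 = 1 := by
      rw [pow_two]; exact hθ (h2.trans (map_one θ).symm)
    have h4 : b = 1 := (pow_eq_one_iff_left two_ne_zero).1 h3
    subst h4
    simp

theorem exists_wreath_not_commute {θ : F₂ →* (F₂ × F₂) ⋊[act] C₂}
    (hθ : Function.Injective θ) : ∃ a b, (θ a).right = 1 ∧ (θ b).right = 1 ∧
      (¬ Commute (θ a).left.1 (θ b).left.1 ∨ ¬ Commute (θ a).left.2 (θ b).left.2) := by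
  have hr : ∀ g, (θ (g * g)).right = 1 := fun g => by
    rw [map_mul, SemidirectProduct.mul_right, C₂.mul_self]
  let x : F₂ := FreeGroup.of 0
  let y : F₂ := FreeGroup.of 1
  refine ⟨x * x, y * y, hr x, hr y, ?_⟩
  by_contra! h
  have h1 : Commute (θ (x * x)) (θ (y * y)) := by
    refine SemidirectProduct.ext ?_ ?_
    · rw [wreath_left_mul (hr x), wreath_left_mul (hr y)]
      exact Prod.ext h.1 h.2
    · exact mul_comm _ _
  have h2 : (x * x) * (y * y) = (y * y) * (x * x) := hθ (by rw [map_mul θ, h1.eq, ← map_mul])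
  revert h2
  decide

/-- An endomorphism of `F₂` read off from a homomorphism into the base group. -/
def wreathCoord (π : F₂ × F₂ →* F₂) (θ : F₂ →* (F₂ × F₂) ⋊[act] C₂)
    (hθ : ∀ a, (θ a).right = 1) : F₂ →* F₂ :=
  MonoidHom.mk' (fun a => π (θ a).left) fun a b => by
    rw [map_mul, wreath_left_mul (hθ a), map_mul]

theorem mul_swap_eq_one_of_fst (x : F₂ × F₂) (h : (MonoidHom.fst F₂ F₂) (x * (x.2, x.1)) = 1) :
    x * (x.2, x.1) = 1 :=
  Prod.ext h (mul_eq_one_comm.1 h)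

theorem mul_swap_eq_one_of_snd (x : F₂ × F₂) (h : (MonoidHom.snd F₂ F₂) (x * (x.2, x.1)) = 1) :
    x * (x.2, x.1) = 1 :=
  Prod.ext (mul_eq_one_comm.1 h) h

/-- Every automorphism of the wreath product preserves the base group, and either preserves or
exchanges the two factors. -/
theorem wreath_aut_base
    (hact : ∀ x : F₂ × F₂, act (Multiplicative.ofAdd 1) x = (x.2, x.1))
    (ψ : (F₂ × F₂) ⋊[act] C₂ ≃* (F₂ × F₂) ⋊[act] C₂) :
    ∃ α β : F₂ →* F₂,
      (∀ x : F₂ × F₂, ψ (SemidirectProduct.inl x) = SemidirectProduct.inl (α x.1, β x.2)) ∨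
      (∀ x : F₂ × F₂, ψ (SemidirectProduct.inl x) = SemidirectProduct.inl (β x.2, α x.1)) := by
  let θ₁ : F₂ →* (F₂ × F₂) ⋊[act] C₂ :=
    ψ.toMonoidHom.comp (SemidirectProduct.inl.comp (MonoidHom.inl F₂ F₂))
  let θ₂ : F₂ →* (F₂ × F₂) ⋊[act] C₂ :=
    ψ.toMonoidHom.comp (SemidirectProduct.inl.comp (MonoidHom.inr F₂ F₂))
  have hθ₁ : Function.Injective θ₁ := ψ.injective.comp
    (SemidirectProduct.inl_injective.comp (Prod.mk_left_injective 1))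
  have hθ₂ : Function.Injective θ₂ := ψ.injective.comp
    (SemidirectProduct.inl_injective.comp (Prod.mk_right_injective 1))
  have hcomm : ∀ a b, Commute (θ₁ a) (θ₂ b) := fun a b =>
    ((MonoidHom.commute_inl_inr a b).map SemidirectProduct.inl).map ψ.toMonoidHom
  have hsplit : ∀ x : F₂ × F₂, ψ (SemidirectProduct.inl x) = θ₁ x.1 * θ₂ x.2 := fun x => by
    change _ = ψ (SemidirectProduct.inl (x.1, 1)) * ψ (SemidirectProduct.inl (1, x.2))
    rw [← map_mul, ← map_mul, Prod.mk_mul_mk, mul_one, one_mul]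
  obtain ⟨a, b, ha, hb, hab⟩ := exists_wreath_not_commute hθ₁
  obtain ⟨c, d, hc, hd, hcd⟩ := exists_wreath_not_commute hθ₂
  rcases hab with hab | hab
  · have h₂ := wreath_right_eq_one_of_commute hact (.fst _ _) mul_swap_eq_one_of_fst hθ₂ ha hb hab
      (fun g => (hcomm a g).symm) (fun g => (hcomm b g).symm)
    replace hcd := hcd.resolve_left fun h => h (by
      rw [show (θ₂ c).left.1 = 1 from (h₂ c).2]; exact Commute.one_left _)
    have h₁ := wreath_right_eq_one_of_commute hact (.snd _ _) mul_swap_eq_one_of_snd hθ₁ hc hd hcd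
      (fun g => hcomm g c) (fun g => hcomm g d)
    refine ⟨wreathCoord (.fst _ _) θ₁ fun g => (h₁ g).1,
      wreathCoord (.snd _ _) θ₂ fun g => (h₂ g).1, Or.inl fun x => ?_⟩
    rw [hsplit, wreath_eq_inl (h₁ x.1).1, wreath_eq_inl (h₂ x.2).1, ← map_mul]
    refine congrArg _ (Prod.ext ?_ ?_)
    · exact (congrArg (_ * ·) (h₂ x.2).2).trans (mul_one _)
    · exact (congrArg (· * _) (h₁ x.1).2).trans (one_mul _)
  · have h₂ := wreath_right_eq_one_of_commute hact (.snd _ _) mul_swap_eq_one_of_snd hθ₂ ha hb hab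
      (fun g => (hcomm a g).symm) (fun g => (hcomm b g).symm)
    replace hcd := hcd.resolve_right fun h => h (by
      rw [show (θ₂ c).left.2 = 1 from (h₂ c).2]; exact Commute.one_left _)
    have h₁ := wreath_right_eq_one_of_commute hact (.fst _ _) mul_swap_eq_one_of_fst hθ₁ hc hd hcd
      (fun g => hcomm g c) (fun g => hcomm g d)
    refine ⟨wreathCoord (.snd _ _) θ₁ fun g => (h₁ g).1,
      wreathCoord (.fst _ _) θ₂ fun g => (h₂ g).1, Or.inr fun x => ?_⟩
    rw [hsplit, wreath_eq_inl (h₁ x.1).1, wreath_eq_inl (h₂ x.2).1, ← map_mul]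
    refine congrArg _ (Prod.ext ?_ ?_)
    · exact (congrArg (· * _) (h₁ x.1).2).trans (one_mul _)
    · exact (congrArg (_ * ·) (h₂ x.2).2).trans (mul_one _)

theorem Subgroup.fg_map {G G' : Type*} [Group G] [Group G'] {B : Subgroup G} (hB : B.FG)
    (f : G →* G') : (B.map f).FG := by
  rw [Subgroup.fg_iff] at hB ⊢
  obtain ⟨S, rfl, hS⟩ := hB
  exact ⟨f '' S, (f.map_closure S).symm, hS.image f⟩

/-- The fixed points of an automorphism of the wreath product that lie in the base group form a
finitely generated subgroup. -/
theorem wreath_fixed_base_fg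
    (hact : ∀ x : F₂ × F₂, act (Multiplicative.ofAdd 1) x = (x.2, x.1))
    (ψ : (F₂ × F₂) ⋊[act] C₂ ≃* (F₂ × F₂) ⋊[act] C₂) :
    (fixedSubgroup ψ ⊓ (SemidirectProduct.rightHom (φ := act)).ker).FG := by
  suffices H : ∃ B : Subgroup (F₂ × F₂), B.FG ∧
      ∀ x, x ∈ B ↔ ψ (SemidirectProduct.inl x) = SemidirectProduct.inl x by
    obtain ⟨B, hB, h⟩ := H
    convert Subgroup.fg_map hB (SemidirectProduct.inl (φ := act)) using 1
    ext p
    rw [Subgroup.mem_inf, MonoidHom.mem_ker, Subgroup.mem_map]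
    constructor
    · rintro ⟨h1, h2⟩
      have e := wreath_eq_inl h2
      refine ⟨p.left, (h _).2 ?_, e.symm⟩
      rw [← e]
      exact h1
    · rintro ⟨x, hx, rfl⟩
      exact ⟨(h x).1 hx, SemidirectProduct.rightHom_inl x⟩
  obtain ⟨α, β, h | h⟩ := wreath_aut_base hact ψ
  · refine ⟨_, (FreeGroup.eqLocus_id_fg α).prod (FreeGroup.eqLocus_id_fg β), fun x => ?_⟩
    rw [h, SemidirectProduct.inl_inj, Subgroup.mem_prod, Prod.ext_iff]
    rfl
  · refine ⟨_, Subgroup.fg_map (FreeGroup.eqLocus_id_fg (β.comp α)) ((MonoidHom.id _).prod α), fun x => ?_⟩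
    rw [h, SemidirectProduct.inl_inj, Subgroup.mem_map, Prod.ext_iff]
    constructor
    · rintro ⟨g, hg, rfl⟩
      exact ⟨hg, rfl⟩
    · rintro ⟨h1, h2⟩
      refine ⟨x.1, ?_, Prod.ext rfl h2⟩
      change β (α x.1) = x.1
      rw [show α x.1 = x.2 from h2]
      exact h1

theorem wreath_FGFPa
    (hact : ∀ x : F₂ × F₂, act (Multiplicative.ofAdd 1) x = (x.2, x.1)) :
    FGFPa ((F₂ × F₂) ⋊[act] C₂) := by
  intro ψ
  rw [Group.fg_iff_subgroup_fg]
  have hfg := wreath_fixed_base_fg hact ψ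
  set K := fixedSubgroup ψ ⊓ (SemidirectProduct.rightHom (φ := act)).ker
  by_cases h : ∃ t ∈ fixedSubgroup ψ, t.right ≠ 1
  · obtain ⟨t, ht, htr⟩ := h
    have e : fixedSubgroup ψ = K ⊔ Subgroup.zpowers t := by
      refine le_antisymm (fun g hg => ?_) (sup_le inf_le_left (by simpa using ht))
      by_cases hgr : g.right = 1
      · exact Subgroup.mem_sup_left ⟨hg, hgr⟩
      · have hgt : g * t⁻¹ ∈ K := by
          refine Subgroup.mem_inf.2 ⟨mul_mem hg (inv_mem ht), ?_⟩
          rw [MonoidHom.mem_ker, map_mul, map_inv]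
          change g.right * t.right⁻¹ = 1
          rw [(C₂.eq_one_or _).resolve_left hgr, (C₂.eq_one_or _).resolve_left htr, mul_inv_cancel]
        rw [← inv_mul_cancel_right g t]
        exact Subgroup.mul_mem_sup hgt (Subgroup.mem_zpowers t)
    rw [e]
    exact hfg.sup ⟨{t}, by simp [Subgroup.zpowers_eq_closure]⟩
  · push Not at h
    have e : fixedSubgroup ψ = K := le_antisymm (fun g hg => ⟨hg, h g hg⟩) inf_le_left
    rwa [e]

end Wreath

section WreathCommutator

open scoped commutatorElement

variable {act : C₂ →* MulAut (F₂ × F₂)}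

/-- The product of the two coordinates in the abelianization, together with the top component. -/
def wreathAbelianize
    (hact : ∀ x : F₂ × F₂, act (Multiplicative.ofAdd 1) x = (x.2, x.1)) :
    (F₂ × F₂) ⋊[act] C₂ →* Abelianization F₂ × C₂ :=
  SemidirectProduct.lift
    ((MonoidHom.inl _ _).comp (Abelianization.of.coprod Abelianization.of)) (MonoidHom.inr _ _) (by
      intro c
      ext x : 1
      rcases C₂.eq_one_or c with rfl | rfl
      · simp
      · simp [hact, mul_comm])

theorem wreath_commutator_le_ker
    (hact : ∀ x : F₂ × F₂, act (Multiplicative.ofAdd 1) x = (x.2, x.1))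
    {p : (F₂ × F₂) ⋊[act] C₂} (hp : p ∈ commutator ((F₂ × F₂) ⋊[act] C₂)) :
    p.right = 1 ∧ p.left.1 * p.left.2 ∈ commutator F₂ := by
  have h := Abelianization.commutator_subset_ker (wreathAbelianize hact) hp
  rw [MonoidHom.mem_ker, ← SemidirectProduct.inl_left_mul_inr_right p, map_mul, wreathAbelianize,
    SemidirectProduct.lift_inl, SemidirectProduct.lift_inr, Prod.ext_iff] at h
  obtain ⟨h1, h2⟩ := h
  simp only [MonoidHom.comp_apply, MonoidHom.coprod_apply, MonoidHom.inl_apply,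
    MonoidHom.inr_apply, Prod.mk_mul_mk, mul_one, one_mul, Prod.fst_one, Prod.snd_one] at h1 h2
  refine ⟨h2, ?_⟩
  rw [← map_mul] at h1
  rwa [← Abelianization.ker_of F₂, MonoidHom.mem_ker]

/-- A normal subgroup of `F₂` containing the commutator of the generators contains the
commutator subgroup. -/
theorem commutator_le_of_commutatorElement_mem {M : Subgroup F₂} [M.Normal]
    (h : ⁅(FreeGroup.of 0 : F₂), FreeGroup.of 1⁆ ∈ M) : commutator F₂ ≤ M := by
  have hxy : Commute (QuotientGroup.mk' M (FreeGroup.of 0))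
      (QuotientGroup.mk' M (FreeGroup.of 1)) := by
    rw [← commutatorElement_eq_one_iff_commute, ← map_commutatorElement]
    exact (QuotientGroup.eq_one_iff _).2 h
  have hcomm := FreeGroup.commute_map_of_commute (QuotientGroup.mk' M) (by
    intro i j
    fin_cases i <;> fin_cases j
    · exact Commute.refl _
    · exact hxy
    · exact hxy.symm
    · exact Commute.refl _)
  rw [commutator_def, Subgroup.commutator_le]
  intro g _ g' _
  rw [← QuotientGroup.eq_one_iff]
  change QuotientGroup.mk' M ⁅g, g'⁆ = 1
  rw [map_commutatorElement, commutatorElement_eq_one_iff_commute]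
  exact hcomm g g'

theorem wreath_commutator_fg
    (hact : ∀ x : F₂ × F₂, act (Multiplicative.ofAdd 1) x = (x.2, x.1)) :
    (commutator ((F₂ × F₂) ⋊[act] C₂)).FG := by
  let inl : F₂ × F₂ →* (F₂ × F₂) ⋊[act] C₂ := SemidirectProduct.inl
  let x : Fin 2 → F₂ := FreeGroup.of
  let Y : Set (F₂ × F₂) := insert (1, ⁅x 0, x 1⁆) (Set.range fun i => (x i, (x i)⁻¹))
  set L := Subgroup.closure Y with hL
  have hgen : ∀ i, (x i, (x i)⁻¹) ∈ L := fun i => Subgroup.subset_closure (Or.inr ⟨i, rfl⟩)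
  have hsnd : ∀ g : F₂, ∃ k, (k, g) ∈ L := by
    intro g
    induction g using FreeGroup.induction_on with
    | C1 => exact ⟨1, one_mem L⟩
    | of i => exact ⟨_, by simpa using inv_mem (hgen i)⟩
    | inv_of i _ => exact ⟨_, hgen i⟩
    | mul g h hg hh =>
      obtain ⟨k, hk⟩ := hg
      obtain ⟨k', hk'⟩ := hh
      exact ⟨k * k', mul_mem hk hk'⟩
  let M : Subgroup F₂ := L.comap (MonoidHom.inr F₂ F₂)
  have hM : ∀ c, c ∈ M ↔ ((1 : F₂), c) ∈ L := fun c => Iff.rfl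
  have hMn : M.Normal := by
    refine ⟨fun c hc g => ?_⟩
    obtain ⟨k, hk⟩ := hsnd g
    have := mul_mem (mul_mem hk ((hM c).1 hc)) (inv_mem hk)
    rw [hM]
    simpa using this
  have hcomm : commutator F₂ ≤ M := commutator_le_of_commutatorElement_mem
    (Subgroup.subset_closure (Or.inl rfl))
  have hanti : ∀ g : F₂, (g, g⁻¹) ∈ L := by
    intro g
    induction g using FreeGroup.induction_on with
    | C1 => rw [inv_one]; exact one_mem L
    | of i => exact hgen i
    | inv_of i _ => simpa using inv_mem (hgen i)
    | mul g h hg hh =>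
      have hc : ((1 : F₂), ⁅h, g⁆) ∈ L := (hM _).1 (hcomm
        (Subgroup.commutator_mem_commutator (Subgroup.mem_top _) (Subgroup.mem_top _)))
      have : (g * h, (g * h)⁻¹) = (g, g⁻¹) * (h, h⁻¹) * ((1 : F₂), ⁅h, g⁆) := by
        simp [commutatorElement_def, mul_assoc]
      rw [this]
      exact mul_mem (mul_mem hg hh) hc
  suffices H : commutator ((F₂ × F₂) ⋊[act] C₂) = L.map inl by
    rw [H]
    refine Subgroup.fg_map ((Subgroup.fg_iff _).2 ⟨Y, rfl, ?_⟩) inl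
    exact (Set.finite_range _).insert _
  apply le_antisymm
  · intro p hp
    obtain ⟨h1, h2⟩ := wreath_commutator_le_ker hact hp
    refine ⟨p.left, ?_, (wreath_eq_inl h1).symm⟩
    have := mul_mem (hanti p.left.1) ((hM _).1 (hcomm h2))
    simpa using this
  · rw [Subgroup.map_le_iff_le_comap, hL, Subgroup.closure_le]
    rintro _ (rfl | ⟨i, rfl⟩)
    · have e : inl (1, ⁅x 0, x 1⁆) = ⁅inl (1, x 0), inl (1, x 1)⁆ := by
        rw [← map_commutatorElement]
        simp [commutatorElement_def]
      change inl (1, ⁅x 0, x 1⁆) ∈ commutator _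
      rw [e]
      exact Subgroup.commutator_mem_commutator (Subgroup.mem_top _) (Subgroup.mem_top _)
    · have e : inl (x i, (x i)⁻¹) =
          ⁅inl (x i, 1), SemidirectProduct.inr (Multiplicative.ofAdd 1)⁆ := by
        have h := SemidirectProduct.inl_aut (φ := act) (Multiplicative.ofAdd 1) (x i, 1)⁻¹
        rw [commutatorElement_def, mul_assoc, mul_assoc, ← mul_assoc (SemidirectProduct.inr _),
          ← map_inv, ← map_inv, ← h, hact, ← map_mul]
        simp
      change inl (x i, (x i)⁻¹) ∈ commutator _
      rw [e]
      exact Subgroup.commutator_mem_commutator (Subgroup.mem_top _) (Subgroup.mem_top _)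

end WreathCommutator

/-- The wreath product `H = (F₂ × F₂) ⋊ C₂` (with the coordinate
swap action) has FGFPa and its commutator subgroup is finitely generated. -/
theorem wreath_FGFPa_and_commutator_fg (act : C₂ →* MulAut (F₂ × F₂))
    (hact : ∀ x : F₂ × F₂, act (Multiplicative.ofAdd 1) x = (x.2, x.1)) :
    FGFPa ((F₂ × F₂) ⋊[act] C₂) ∧ (commutator ((F₂ × F₂) ⋊[act] C₂)).FG := by
  exact ⟨wreath_FGFPa hact, wreath_commutator_fg hact⟩
end
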